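/- arXiv:0905.3450 — 2 statements merged into one kernel-verified Lean document; each statement's English description precedes it below -/
import Mathlib

section
/- Let F and F_* be probability distribution functions on ℝ with F_* differentiable and |F_*'(x)| ≤ 1 for all x, and suppose the first moments of the measures dF and dF_* exist and are equal. For T > 0 let ψ_T(x) = (1 − cos(Tx))/(π T x²) and set Δ(x) = F(x) − F_*(x), Δ_T = ψ_T * Δ (convolution). Then sup_x |Δ(x)| ≤ 2 sup_x |Δ_T(x)| + 24/(πT). -/
open MeasureTheory Set

lemma aux_inner_t (x : ℝ) (hx : 0 < x) :
    ∫⁻ t in Ioi (0:ℝ), ENNReal.ofReal ((1 - Real.cos x) * (t * Real.exp (-(x * t))))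
      = ENNReal.ofReal ((1 - Real.cos x) / x ^ 2) := by
  have h1 : ∫ t in Ioi (0:ℝ), t * Real.exp (-(x * t)) = 1 / x ^ 2 := by
    have := Real.integral_rpow_mul_exp_neg_mul_Ioi (a := 2) (r := x) (by norm_num) hx
    have h2 : ∀ t : ℝ, t ^ ((2:ℝ) - 1) = t := fun t => by norm_num
    simp only [h2] at this
    rw [this]
    simp
  have hi : Integrable (fun t : ℝ => t * Real.exp (-(x * t))) (volume.restrict (Ioi 0)) := by
    by_contra h
    rw [integral_undef h] at h1
    have : 0 < 1 / x ^ 2 := by positivity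
    linarith
  rw [← ofReal_integral_eq_lintegral_ofReal (hi.const_mul _), integral_const_mul, h1]
  · congr 1; ring
  · filter_upwards [ae_restrict_mem measurableSet_Ioi] with t ht
    have h3 : 0 < t := ht
    have := Real.cos_le_one x
    have h4 : 0 ≤ 1 - Real.cos x := by linarith
    show 0 ≤ (1 - Real.cos x) * (t * Real.exp (-(x * t)))
    positivity

lemma aux_inner_x (t : ℝ) (ht : 0 < t) :
    ∫⁻ x in Ioi (0:ℝ), ENNReal.ofReal ((1 - Real.cos x) * (t * Real.exp (-(x * t))))
      = ENNReal.ofReal ((1 + t ^ 2)⁻¹) := by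
  have hp : (0:ℝ) < 1 + t ^ 2 := by positivity
  have hd : ∀ x ∈ Ici (0:ℝ), HasDerivAt
      (fun x => Real.exp (-(x * t)) * (-1 + t * (t * Real.cos x - Real.sin x) / (1 + t ^ 2)))
      ((1 - Real.cos x) * (t * Real.exp (-(x * t)))) x := by
    intro x _
    have e1 : HasDerivAt (fun x => Real.exp (-(x * t))) (Real.exp (-(x * t)) * (-(1 * t))) x :=
      (((hasDerivAt_id x).mul_const t).neg).exp
    have e2 : HasDerivAt (fun x => (-1 + t * (t * Real.cos x - Real.sin x) / (1 + t ^ 2)))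
        (t * (t * (-Real.sin x) - Real.cos x) / (1 + t ^ 2)) x :=
      (((((Real.hasDerivAt_cos x).const_mul t).sub (Real.hasDerivAt_sin x)).const_mul t).div_const
        _).const_add (-1)
    refine (e1.mul e2).congr_deriv ?_
    field_simp
    ring
  have hn : ∀ x ∈ Ioi (0:ℝ), 0 ≤ (1 - Real.cos x) * (t * Real.exp (-(x * t))) := by
    intro x _
    have := Real.cos_le_one x
    have h4 : 0 ≤ 1 - Real.cos x := by linarith
    positivity
  have hlim : Filter.Tendsto
      (fun x => Real.exp (-(x * t)) * (-1 + t * (t * Real.cos x - Real.sin x) / (1 + t ^ 2)))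
      Filter.atTop (nhds 0) := by
    apply Filter.Tendsto.zero_mul_isBoundedUnder_le
    · apply Real.tendsto_exp_neg_atTop_nhds_zero.comp
      exact Filter.tendsto_id.atTop_mul_const ht
    · refine Filter.isBoundedUnder_of ⟨1 + t * (t + 1) / (1 + t ^ 2), fun x => ?_⟩
      simp only [Function.comp, Real.norm_eq_abs]
      refine (abs_add_le _ _).trans ?_
      rw [abs_div, abs_mul, abs_of_pos ht, abs_of_pos hp, abs_neg, abs_one]
      gcongr
      refine (abs_sub _ _).trans ?_
      rw [abs_mul, abs_of_pos ht]
      have h1 := Real.abs_cos_le_one x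
      have h2 := Real.abs_sin_le_one x
      nlinarith
  have hval := integral_Ioi_of_hasDerivAt_of_nonneg' hd hn hlim
  have hi := integrableOn_Ioi_deriv_of_nonneg' hd hn hlim
  rw [← ofReal_integral_eq_lintegral_ofReal hi, hval]
  · congr 1
    simp
    field_simp
    ring
  · filter_upwards [ae_restrict_mem measurableSet_Ioi] with x hx using hn x hx

lemma aux_lint : ∫⁻ x in Ioi (0:ℝ), ENNReal.ofReal ((1 - Real.cos x) / x ^ 2)
    = ENNReal.ofReal (Real.pi / 2) := by
  calc _ = ∫⁻ x in Ioi (0:ℝ), ∫⁻ t in Ioi (0:ℝ),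
        ENNReal.ofReal ((1 - Real.cos x) * (t * Real.exp (-(x * t)))) :=
        setLIntegral_congr_fun measurableSet_Ioi fun x hx => (aux_inner_t x hx).symm
    _ = ∫⁻ t in Ioi (0:ℝ), ∫⁻ x in Ioi (0:ℝ),
        ENNReal.ofReal ((1 - Real.cos x) * (t * Real.exp (-(x * t)))) := by
        apply lintegral_lintegral_swap
        apply Measurable.aemeasurable
        apply Measurable.ennreal_ofReal
        apply Continuous.measurable
        fun_prop
    _ = ∫⁻ t in Ioi (0:ℝ), ENNReal.ofReal ((1 + t ^ 2)⁻¹) :=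
        setLIntegral_congr_fun measurableSet_Ioi fun t ht => aux_inner_x t ht
    _ = _ := by
        rw [← ofReal_integral_eq_lintegral_ofReal integrable_inv_one_add_sq.integrableOn,
          integral_Ioi_inv_one_add_sq]
        · simp
        · filter_upwards with t
          show (0:ℝ) ≤ (1 + t ^ 2)⁻¹
          positivity

lemma aux_int : ∫ x : ℝ, (1 - Real.cos x) / x ^ 2 = Real.pi := by
  have h0 : ∀ x : ℝ, 0 ≤ (1 - Real.cos x) / x ^ 2 := fun x => by
    have := Real.cos_le_one x
    have h4 : 0 ≤ 1 - Real.cos x := by linarith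
    positivity
  have h1 : ∫ x in Ioi (0:ℝ), (1 - Real.cos x) / x ^ 2 = Real.pi / 2 := by
    rw [integral_eq_lintegral_of_nonneg_ae (Filter.Eventually.of_forall h0), aux_lint,
      ENNReal.toReal_ofReal (by positivity)]
    apply Measurable.aestronglyMeasurable
    fun_prop
  have h2 := integral_comp_abs (f := fun x : ℝ => (1 - Real.cos x) / x ^ 2)
  simp only [Real.cos_abs, sq_abs] at h2
  rw [h2, h1]; ring

lemma aux_psi (T : ℝ) (hT : 0 < T) :
    ∫ x : ℝ, (1 - Real.cos (T * x)) / (Real.pi * T * x ^ 2) = 1 := by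
  have hpi := Real.pi_pos
  have h : ∀ x : ℝ, (1 - Real.cos (T * x)) / (Real.pi * T * x ^ 2)
      = T / Real.pi * ((1 - Real.cos (T * x)) / (T * x) ^ 2) := by
    intro x
    by_cases hx : x = 0
    · simp [hx]
    · field_simp
  simp_rw [h]
  rw [integral_const_mul,
    Measure.integral_comp_mul_left (fun u : ℝ => (1 - Real.cos u) / u ^ 2) T, aux_int,
    abs_of_pos (by positivity)]
  simp only [smul_eq_mul]
  field_simp

lemma aux_tail (h : ℝ) (hh : 0 < h) :
    Integrable (fun x : ℝ => (Ioi h).indicator (fun r : ℝ => 1 / r ^ 2) |x|) ∧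
    ∫ x : ℝ, (Ioi h).indicator (fun r : ℝ => 1 / r ^ 2) |x| = 2 / h := by
  have h1 : ∫ r in Ioi h, 1 / r ^ 2 = 1 / h := by
    have := integral_Ioi_rpow_of_lt (a := -2) (by norm_num) hh
    rw [setIntegral_congr_fun (g := fun r : ℝ => r ^ (-2:ℝ)) measurableSet_Ioi, this]
    · norm_num [Real.rpow_neg_one]
    · intro r hr
      have : 0 < r := hh.trans hr
      show 1 / r ^ 2 = r ^ (-2:ℝ)
      rw [Real.rpow_neg this.le]; simp
  have h2 := integral_comp_abs (f := (Ioi h).indicator (fun r : ℝ => 1 / r ^ 2))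
  rw [setIntegral_indicator measurableSet_Ioi, Ioi_inter_Ioi, max_eq_right hh.le, h1] at h2
  have h3 : ∫ x : ℝ, (Ioi h).indicator (fun r : ℝ => 1 / r ^ 2) |x| = 2 / h := by
    rw [h2]; ring
  refine ⟨?_, h3⟩
  by_contra hc
  rw [integral_undef hc] at h3
  have : 0 < 2 / h := by positivity
  linarith

/-- The central estimate, for a translated (and possibly reflected) `Δ`. -/
lemma aux_core (T : ℝ) (hT : 0 < T)
    (ψ : ℝ → ℝ) (hψ : ∀ x, ψ x = (1 - Real.cos (T * x)) / (Real.pi * T * x ^ 2))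
    (hψi : Integrable ψ) (hψ1 : ∫ x, ψ x = 1)
    (E : ℝ → ℝ) (hEm : Measurable E) (η δ : ℝ) (hδ : 0 < δ)
    (hEη : ∀ x, |E x| ≤ η) (hE : ∀ x, |x| ≤ δ / 2 → δ / 2 + x ≤ E x) :
    δ / 2 - (δ / 2 + η) * (8 / (Real.pi * T) / δ) ≤ ∫ x, ψ x * E x := by
  have hpi := Real.pi_pos
  have hη : 0 ≤ η := (abs_nonneg _).trans (hEη 0)
  have hψ0 : ∀ x, 0 ≤ ψ x := fun x => by
    rw [hψ]
    have := Real.cos_le_one (T * x)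
    have h4 : 0 ≤ 1 - Real.cos (T * x) := by linarith
    positivity
  obtain ⟨ti, tv⟩ := aux_tail (δ / 2) (by positivity)
  set k : ℝ → ℝ := fun x => (Ioi (δ / 2)).indicator (fun r : ℝ => 1 / r ^ 2) |x| with hk
  set o : ℝ → ℝ := fun x => (Icc (-(δ / 2)) (δ / 2)).indicator (fun r : ℝ => r) x with ho
  have hoi : Integrable (fun x => ψ x * o x) := by
    refine hψi.mul_bdd (c := δ / 2) ?_ ?_
    · exact (measurable_id.indicator measurableSet_Icc).aestronglyMeasurable
    · refine Filter.Eventually.of_forall fun x => ?_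
      simp only [ho, indicator, Real.norm_eq_abs]
      split_ifs with hx
      · exact abs_le.mpr hx
      · simp; positivity
  have hov : ∫ x, ψ x * o x = 0 := by
    have h1 := integral_neg_eq_self (fun x => ψ x * o x) volume
    have h2 : ∀ x, ψ (-x) * o (-x) = -(ψ x * o x) := by
      intro x
      have e1 : ψ (-x) = ψ x := by simp [hψ]
      have e2 : o (-x) = - o x := by
        by_cases hx : x ∈ Icc (-(δ / 2)) (δ / 2)
        · have hx' : -x ∈ Icc (-(δ / 2)) (δ / 2) := ⟨by linarith [hx.2], by linarith [hx.1]⟩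
          simp only [ho, indicator_of_mem hx, indicator_of_mem hx']
        · have hx' : -x ∉ Icc (-(δ / 2)) (δ / 2) :=
            fun h => hx ⟨by linarith [h.2], by linarith [h.1]⟩
          simp only [ho, indicator_of_notMem hx, indicator_of_notMem hx', neg_zero]
      rw [e1, e2]; ring
    simp only [h2] at h1
    rw [integral_neg] at h1
    linarith
  have hEi : Integrable (fun x => ψ x * E x) :=
    hψi.mul_bdd (c := η) hEm.aestronglyMeasurable (Filter.Eventually.of_forall hEη)
  have hsum : Integrable (fun x => δ / 2 * ψ x + ψ x * o x) := (hψi.const_mul _).add hoi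
  have hlow : ∫ x, (δ / 2 * ψ x + ψ x * o x - (δ / 2 + η) * (2 / (Real.pi * T)) * k x)
      = δ / 2 - (δ / 2 + η) * (8 / (Real.pi * T) / δ) := by
    rw [integral_sub hsum (ti.const_mul _),
      integral_add (hψi.const_mul _) hoi, integral_const_mul, integral_const_mul, hψ1, hov, tv]
    field_simp
    ring
  rw [← hlow]
  refine integral_mono (((hψi.const_mul _).add hoi).sub (ti.const_mul _)) hEi fun x => ?_
  show δ / 2 * ψ x + ψ x * o x - (δ / 2 + η) * (2 / (Real.pi * T)) * k x ≤ ψ x * E x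
  by_cases hx : |x| ≤ δ / 2
  · have hx' : x ∈ Icc (-(δ / 2)) (δ / 2) := abs_le.mp hx
    have e1 : o x = x := by simp only [ho, indicator_of_mem hx']
    have e2 : k x = 0 := by
      simp only [hk]; exact indicator_of_notMem (by simpa using hx) _
    rw [e1, e2]
    have := mul_le_mul_of_nonneg_left (hE x hx) (hψ0 x)
    linarith
  · have hx' : x ∉ Icc (-(δ / 2)) (δ / 2) := fun h => hx (abs_le.mpr h)
    have e1 : o x = 0 := by simp only [ho, indicator_of_notMem hx']
    have e2 : k x = 1 / x ^ 2 := by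
      simp only [hk]
      rw [indicator_of_mem (by simpa using hx), sq_abs]
    have h0 : 0 < |x| := lt_trans (by positivity) (not_le.mp hx)
    have hx0 : x ≠ 0 := abs_pos.mp h0
    have e3 : ψ x ≤ 2 / (Real.pi * T) * k x := by
      rw [e2, hψ, div_mul_div_comm, mul_one]
      have := Real.neg_one_le_cos (T * x)
      gcongr
      linarith
    have e4 : ψ x * (-η) ≤ ψ x * E x :=
      mul_le_mul_of_nonneg_left (abs_le.mp (hEη x)).1 (hψ0 x)
    have e5 := mul_le_mul_of_nonneg_left e3 (show 0 ≤ δ / 2 + η by positivity)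
    rw [e1]
    linarith

/-- Feller's smoothing lemma (XVI.3): if `F` and `Fs` are probability distribution
functions, `Fs` is differentiable with `|Fs'| ≤ 1`, and the first moments of the
corresponding measures exist and agree, then with the mollifier
`ψ_T(x) = (1 - cos(Tx))/(π T x²)` and `Δ = F - Fs`, `Δ_T = ψ_T * Δ`, one has
`sup |Δ| ≤ 2 sup |Δ_T| + 24/(π T)`. -/
theorem smoothing_lemma
    (μ ν : Measure ℝ) [IsProbabilityMeasure μ] [IsProbabilityMeasure ν]
    (F Fs : ℝ → ℝ)
    (hF : ∀ x, F x = (μ (Iic x)).toReal)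
    (hFs : ∀ x, Fs x = (ν (Iic x)).toReal)
    (hFsDiff : Differentiable ℝ Fs)
    (hFsDeriv : ∀ x, |deriv Fs x| ≤ 1)
    (hμmom : Integrable (fun x : ℝ => x) μ)
    (hνmom : Integrable (fun x : ℝ => x) ν)
    (hmom : (∫ x, x ∂μ) = ∫ x, x ∂ν)
    (T : ℝ) (hT : 0 < T)
    (ψ : ℝ → ℝ) (hψ : ∀ x, ψ x = (1 - Real.cos (T * x)) / (Real.pi * T * x ^ 2))
    (Δ ΔT : ℝ → ℝ)
    (hΔ : ∀ x, Δ x = F x - Fs x)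
    (hΔT : ∀ x, ΔT x = ∫ y, ψ (x - y) * Δ y) :
    (⨆ x, |Δ x|) ≤ 2 * (⨆ x, |ΔT x|) + 24 / (Real.pi * T) := by
  have hpi := Real.pi_pos
  have hψ1 : ∫ x, ψ x = 1 := by
    rw [← aux_psi T hT]; simp only [hψ]
  have hψi : Integrable ψ := by
    by_contra h
    rw [integral_undef h] at hψ1
    norm_num at hψ1
  have hψ0 : ∀ x, 0 ≤ ψ x := fun x => by
    rw [hψ]
    have := Real.cos_le_one (T * x)
    have h4 : 0 ≤ 1 - Real.cos (T * x) := by linarith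
    positivity
  have hψe : ∀ x, ψ (-x) = ψ x := fun x => by simp [hψ]
  have hFmono : Monotone F := fun a b hab => by
    rw [hF, hF]
    exact ENNReal.toReal_mono (measure_ne_top _ _) (measure_mono (Iic_subset_Iic.mpr hab))
  have hF0 : ∀ x, 0 ≤ F x := fun x => by rw [hF]; exact ENNReal.toReal_nonneg
  have hFs0 : ∀ x, 0 ≤ Fs x := fun x => by rw [hFs]; exact ENNReal.toReal_nonneg
  have hF1 : ∀ x, F x ≤ 1 := fun x => by rw [hF]; exact (ENNReal.toReal_mono ENNReal.one_ne_top prob_le_one).trans_eq ENNReal.toReal_one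
  have hFs1 : ∀ x, Fs x ≤ 1 := fun x => by rw [hFs]; exact (ENNReal.toReal_mono ENNReal.one_ne_top prob_le_one).trans_eq ENNReal.toReal_one
  have hΔ1 : ∀ x, |Δ x| ≤ 1 := fun x => by
    rw [hΔ, abs_le]
    constructor <;> linarith [hF0 x, hFs0 x, hF1 x, hFs1 x]
  have hΔm : Measurable Δ := by
    rw [show Δ = fun x => F x - Fs x from funext hΔ]
    exact hFmono.measurable.sub hFsDiff.continuous.measurable
  have hlip : ∀ a b, a ≤ b → Fs b - Fs a ≤ b - a := fun a b hab => by
    have := image_sub_le_mul_sub_of_deriv_le hFsDiff (C := 1)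
      (fun x => (abs_le.mp (hFsDeriv x)).2) hab
    linarith
  have hstep : ∀ a b, a ≤ b → Δ a - (b - a) ≤ Δ b := fun a b hab => by
    rw [hΔ, hΔ]
    linarith [hlip a b hab, hFmono hab]
  have bΔ : BddAbove (range fun x => |Δ x|) := ⟨1, by rintro _ ⟨x, rfl⟩; exact hΔ1 x⟩
  have hconv1 : ∀ t, ΔT t = ∫ x, ψ x * Δ (t - x) := fun t => by
    rw [hΔT, ← integral_sub_left_eq_self _ volume t]
    simp
  have hconv2 : ∀ t, ΔT t = ∫ x, ψ x * Δ (t + x) := fun t => by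
    rw [hconv1, ← integral_neg_eq_self]
    simp [hψe]
  have bΔT : BddAbove (range fun x => |ΔT x|) := by
    refine ⟨1, ?_⟩
    rintro _ ⟨t, rfl⟩
    show |ΔT t| ≤ 1
    rw [hconv1, ← Real.norm_eq_abs, ← hψ1]
    refine norm_integral_le_of_norm_le hψi (Filter.Eventually.of_forall fun x => ?_)
    rw [norm_mul, Real.norm_eq_abs, Real.norm_eq_abs, abs_of_nonneg (hψ0 x)]
    exact mul_le_of_le_one_right (hψ0 x) (hΔ1 _)
  set η := ⨆ x, |Δ x| with hη
  set M := ⨆ x, |ΔT x| with hM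
  have hΔη : ∀ x, |Δ x| ≤ η := fun x => le_ciSup bΔ x
  have hΔM : ∀ x, |ΔT x| ≤ M := fun x => le_ciSup bΔT x
  have hM0 : 0 ≤ M := (abs_nonneg _).trans (hΔM 0)
  have hη0 : 0 ≤ η := (abs_nonneg _).trans (hΔη 0)
  set c := 8 / (Real.pi * T) with hc
  have hc0 : 0 < c := by positivity
  have key : ∀ x, 0 < |Δ x| → |Δ x| / 2 - (|Δ x| / 2 + η) * (c / |Δ x|) ≤ M := by
    intro x₀ hx₀
    rcases lt_or_ge 0 (Δ x₀) with hpos | hneg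
    · rw [abs_of_pos hpos] at hx₀ ⊢
      set δ := Δ x₀ with hδ
      have := aux_core T hT ψ hψ hψi hψ1 (fun x => Δ (x₀ + δ / 2 - x))
        (hΔm.comp (measurable_const.sub measurable_id)) η δ hx₀ (fun x => hΔη _) (fun x hx => by
          have := hstep x₀ (x₀ + δ / 2 - x) (by linarith [(abs_le.mp hx).2])
          linarith)
      rw [← hconv1] at this
      exact this.trans ((le_abs_self _).trans (hΔM _))
    · rw [abs_of_nonpos hneg] at hx₀ ⊢
      set δ := -Δ x₀ with hδ
      have := aux_core T hT ψ hψ hψi hψ1 (fun x => -Δ (x₀ - δ / 2 + x))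
        (hΔm.comp (measurable_const.add measurable_id)).neg η δ hx₀
        (fun x => by rw [abs_neg]; exact hΔη _) (fun x hx => by
          have := hstep (x₀ - δ / 2 + x) x₀ (by linarith [(abs_le.mp hx).2])
          linarith)
      simp only [mul_neg] at this
      rw [integral_neg, ← hconv2] at this
      exact this.trans ((neg_le_abs _).trans (hΔM _))
  have h24 : 24 / (Real.pi * T) = 3 * c := by rw [hc]; ring
  rw [h24]
  by_contra hcon
  push Not at hcon
  have hg : 0 < η - (2 * M + 3 * c) := by linarith
  have hηp : 0 < η := by linarith
  set g := η - (2 * M + 3 * c) with hgd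
  have hden : 0 < η + 2 * c + g := by linarith
  have hs0 : 0 < g * η / (η + 2 * c + g) := by positivity
  obtain ⟨x, hx⟩ := exists_lt_of_lt_ciSup (show η - g * η / (η + 2 * c + g) < ⨆ x, |Δ x| by
    rw [← hη]; linarith)
  have hs1 : g * η / (η + 2 * c + g) < η := by
    rw [div_lt_iff₀ hden]; nlinarith
  have hδ : 0 < |Δ x| := by linarith
  have hk := key x hδ
  set δ := |Δ x| with hδd
  have hle : δ ≤ η := hΔη x
  have h1 : (δ / 2 - (δ / 2 + η) * (c / δ)) * (2 * δ) ≤ M * (2 * δ) := by gcongr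
  have h2 : (δ / 2 - (δ / 2 + η) * (c / δ)) * (2 * δ) = δ ^ 2 - (δ + 2 * η) * c := by
    field_simp
  have h3 : (η - δ) * (η + 2 * c + g) < g * η := by
    rw [← lt_div_iff₀ hden]; linarith
  have h4 : 2 * M = η - 3 * c - g := by rw [hgd]; ring
  have h5 : 2 * M * δ = (η - 3 * c - g) * δ := by rw [h4]
  nlinarith [sq_nonneg (η - δ)]
end

section
/- Let n_0 be a positive Borel measure on (0,∞) with ∫ n_0(dx) = ∫ x n_0(dx) = 1 and μ_2 = ∫ x² n_0(dx) < ∞. Suppose (n(t,·))_{t∈[1,∞)} is a weak solution of Smoluchowski's coagulation equation with constant kernel K(x,y) = 2 and n(1,·) = n_0, and for each t let F(τ, x̂) = t · n(t, (0, t x̂]) where τ = log t, and let F_*(x̂) = 1 − e^{−x̂}. Then there is a constant C depending only on μ_2 such that for all τ ∈ [0,∞), sup_{x̂>0} |F(τ, x̂) − F_*(x̂)| ≤ C(μ_2)(1 + τ) e^{−τ}. -/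
open MeasureTheory Set

/-- A family `n t` of finite positive Borel measures on `(0,∞)` (here: measures on `ℝ`
giving no mass to `(-∞,0]`) is a weak solution of Smoluchowski's coagulation equation
with kernel `K` on the time interval `I` if for every smooth compactly supported test
function `φ` with support in `(0,∞)`, the map `t ↦ ∫ φ dn(t)` is differentiable with
derivative `(1/2)∫∫ (φ(x+y) - φ(x) - φ(y)) K(x,y) n(t,dy) n(t,dx)`; moreover the moment
identities obtained from the weak form with the polynomial test functions `x^j`, `j ∈ J`,
hold whenever the corresponding moments are finite. -/
def IsWeakSolution (K : ℝ → ℝ → ℝ) (I : Set ℝ) (n : ℝ → Measure ℝ) (J : Set ℕ) : Prop :=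
  (∀ t ∈ I, IsFiniteMeasure (n t)) ∧
  (∀ t ∈ I, n t (Iic 0) = 0) ∧
  (∀ φ : ℝ → ℝ, ContDiff ℝ (⊤ : ℕ∞) φ → HasCompactSupport φ → tsupport φ ⊆ Ioi 0 →
    ∀ t ∈ I, HasDerivWithinAt (fun r => ∫ x, φ x ∂(n r))
      ((1 / 2) * ∫ x, ∫ y, (φ (x + y) - φ x - φ y) * K x y ∂(n t) ∂(n t)) I t) ∧
  (∀ j ∈ J,
    (∀ t ∈ I, Integrable (fun x => x ^ j) (n t)) →
    (∀ t ∈ I, Integrable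
        (fun p : ℝ × ℝ => ((p.1 + p.2) ^ j - p.1 ^ j - p.2 ^ j) * K p.1 p.2)
        ((n t).prod (n t))) →
    ∀ t ∈ I, HasDerivWithinAt (fun r => ∫ x, x ^ j ∂(n r))
      ((1 / 2) * ∫ p : ℝ × ℝ, ((p.1 + p.2) ^ j - p.1 ^ j - p.2 ^ j) * K p.1 p.2
          ∂((n t).prod (n t))) I t)


lemma aux_compare (K G : ℝ → ℝ) (p A : ℝ) (hp : 0 < p) (hK0 : K 0 = 0)
    (h1 : ∀ a b, 0 ≤ a → a ≤ b → p * (b - a) * G b ≤ K b - K a)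
    (h2 : ∀ a b, 0 ≤ a → a ≤ b → K b - K a ≤ p * (b - a) * G a)
    (h3 : ∀ x, 0 ≤ x → G x ≤ 1 + p - K x)
    (h4 : ∀ x, 0 ≤ x → 1 - A - K x ≤ G x) (x : ℝ) (hx : 0 ≤ x) :
    K x ≤ (1 + p) * (1 - Real.exp (-(p * x))) ∧ (1 - A) * (1 - Real.exp (-(p * x))) ≤ K x := by
  have up : ∀ h, 0 ≤ h → p * h ≤ 1 → ∀ k : ℕ,
      (1 + p) * (1 - p * h) ^ k ≤ 1 + p - K (k * h) := by
    intro h hh hph k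
    induction k with
    | zero => simp [hK0]
    | succ k ih =>
      have hk : 0 ≤ (k : ℝ) * h := by positivity
      have e := h2 (k * h) ((k + 1) * h) hk (by nlinarith)
      have e3 := h3 _ hk
      have e4 : p * h * G (k * h) ≤ p * h * (1 + p - K (k * h)) :=
        mul_le_mul_of_nonneg_left e3 (by positivity)
      have e5 := mul_le_mul_of_nonneg_right ih (by linarith : 0 ≤ 1 - p * h)
      have e6 : p * ((k + 1) * h - k * h) * G (k * h) = p * h * G (k * h) := by ring
      push_cast
      rw [pow_succ]
      nlinarith
  have lo : ∀ h, 0 ≤ h → ∀ k : ℕ,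
      (1 - A - K (k * h)) * (1 + p * h) ^ k ≤ 1 - A := by
    intro h hh k
    induction k with
    | zero => simp [hK0]
    | succ k ih =>
      have hk : 0 ≤ (k : ℝ) * h := by positivity
      have hk1 : 0 ≤ ((k : ℝ) + 1) * h := by positivity
      have e := h1 (k * h) ((k + 1) * h) hk (by nlinarith)
      have e3 := h4 _ hk1
      have e4 : p * h * (1 - A - K ((k + 1) * h)) ≤ p * h * G ((k + 1) * h) :=
        mul_le_mul_of_nonneg_left e3 (by positivity)
      have e6 : p * ((k + 1) * h - k * h) * G ((k + 1) * h) = p * h * G ((k + 1) * h) := by ring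
      have e7 : (1 - A - K ((k + 1) * h)) * (1 + p * h) ≤ 1 - A - K (k * h) := by nlinarith
      have e8 := mul_le_mul_of_nonneg_right e7 (by positivity : 0 ≤ (1 + p * h) ^ k)
      push_cast
      rw [pow_succ]
      nlinarith
  constructor
  · have lim : Filter.Tendsto (fun n : ℕ => (1 + p) * (1 + (-(p * x)) / n) ^ n) Filter.atTop
        (nhds ((1 + p) * Real.exp (-(p * x)))) :=
      (Real.tendsto_one_add_div_pow_exp _).const_mul _
    have : (1 + p) * Real.exp (-(p * x)) ≤ 1 + p - K x := by
      refine le_of_tendsto lim ?_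
      filter_upwards [Filter.eventually_ge_atTop (⌈p * x⌉₊ + 1)] with n hn
      have hn0 : (0 : ℝ) < n := by exact_mod_cast (by omega : 0 < n)
      have hn1 : p * x ≤ n := (Nat.le_ceil _).trans (by exact_mod_cast (by omega))
      have := up (x / n) (by positivity) (by rw [← mul_div_assoc, div_le_one hn0]; exact hn1) n
      rw [mul_div_cancel₀ _ hn0.ne'] at this
      rw [show 1 + -(p * x) / (n : ℝ) = 1 - p * (x / n) by ring]
      exact this
    linarith
  · have lim : Filter.Tendsto (fun n : ℕ => (1 - A - K x) * (1 + (p * x) / n) ^ n) Filter.atTop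
        (nhds ((1 - A - K x) * Real.exp (p * x))) :=
      (Real.tendsto_one_add_div_pow_exp _).const_mul _
    have : (1 - A - K x) * Real.exp (p * x) ≤ 1 - A := by
      refine le_of_tendsto lim ?_
      filter_upwards [Filter.eventually_ge_atTop 1] with n hn
      have hn0 : (0 : ℝ) < n := by exact_mod_cast (by omega : 0 < n)
      have := lo (x / n) (by positivity) n
      rw [mul_div_cancel₀ _ hn0.ne'] at this
      rw [show 1 + p * x / (n : ℝ) = 1 + p * (x / n) by ring]
      exact this
    have h5 := mul_le_mul_of_nonneg_right this (Real.exp_pos (-(p * x))).le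
    rw [mul_assoc, ← Real.exp_add] at h5
    simp only [add_neg_cancel, Real.exp_zero, mul_one] at h5
    linarith

/-- renewal integral identity -/
lemma aux_ren_int {μ ν : Measure ℝ} [IsProbabilityMeasure μ] [IsProbabilityMeasure ν]
    {p q : ℝ} (hp : 0 ≤ p) (hq : 0 ≤ q)
    (hren : ν = ENNReal.ofReal p • Measure.dirac 0 + ENNReal.ofReal q • (μ.conv ν))
    {f : ℝ → ℝ} (hf : Integrable f (μ.conv ν)) :
    ∫ x, f x ∂ν = p * f 0 + q * ∫ x, f x ∂(μ.conv ν) := by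
  have h0 : Integrable f (Measure.dirac (0:ℝ)) := integrable_dirac (by simp)
  conv_lhs => rw [hren]
  rw [integral_add_measure (h0.smul_measure (by simp)) (hf.smul_measure (by simp)),
    integral_smul_measure, integral_smul_measure, integral_dirac]
  simp [hp, hq]

lemma aux_conv_nonneg {μ ν : Measure ℝ} [IsFiniteMeasure μ] [IsFiniteMeasure ν]
    (hμ : μ (Iic 0) = 0) (hν : ν (Iio 0) = 0) : (μ.conv ν) (Iic 0) = 0 := by
  rw [← lintegral_indicator_one measurableSet_Iic, Measure.lintegral_conv
    (measurable_one.indicator measurableSet_Iic)]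
  have h1 : ∀ᵐ x ∂μ, 0 < x := by
    rw [ae_iff]; simpa [Iic] using hμ
  have h2 : ∀ᵐ x ∂ν, 0 ≤ x := by
    rw [ae_iff]; simpa [Iio] using hν
  rw [lintegral_eq_zero_of_ae_eq_zero]
  filter_upwards [h1] with x hx
  rw [lintegral_eq_zero_of_ae_eq_zero]
  · rfl
  filter_upwards [h2] with y hy
  have : ¬ (x + y ≤ 0) := by linarith
  simp [indicator, this]

lemma aux_laplace {μ ν : Measure ℝ} [IsProbabilityMeasure μ] [IsProbabilityMeasure ν]
    {p q m s : ℝ} (hp : 0 < p) (hq : 0 ≤ q) (hpq : p + q = 1)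
    (hμ : μ (Iic 0) = 0) (hν : ν (Iio 0) = 0)
    (hren : ν = ENNReal.ofReal p • Measure.dirac 0 + ENNReal.ofReal q • (μ.conv ν))
    (i1 : Integrable (fun x => x) μ) (e1 : ∫ x, x ∂μ = 1)
    (i2 : Integrable (fun x => x ^ 2) μ) (e2 : ∫ x, x ^ 2 ∂μ = m)
    (hs : 0 < s) (hsm : s * m ≤ 1) :
    ∫ x, Real.exp (-(s * x)) ∂ν ≤ 2 * p / s := by
  have h1 : ∀ᵐ x ∂μ, 0 < x := by
    rw [ae_iff]; simpa [Iic] using hμ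
  have h2 : ∀ᵐ x ∂ν, 0 ≤ x := by
    rw [ae_iff]; simpa [Iio] using hν
  have h3 : ∀ᵐ x ∂(μ.conv ν), 0 < x := by
    rw [ae_iff]; simpa [Iic] using aux_conv_nonneg hμ hν
  have bd : ∀ x : ℝ, 0 ≤ x → ‖Real.exp (-(s * x))‖ ≤ 1 := fun x hx => by
    rw [Real.norm_eq_abs, abs_of_pos (Real.exp_pos _), Real.exp_le_one_iff]
    nlinarith
  have ic : Integrable (fun x => Real.exp (-(s * x))) (μ.conv ν) :=
    Integrable.of_bound (by fun_prop) 1 (h3.mono fun x hx => bd x hx.le)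
  have iμ : Integrable (fun x => Real.exp (-(s * x))) μ :=
    Integrable.of_bound (by fun_prop) 1 (h1.mono fun x hx => bd x hx.le)
  have R := aux_ren_int hp.le hq hren ic
  rw [integral_conv ic] at R
  simp only [mul_add, neg_add, Real.exp_add, integral_const_mul, integral_mul_const] at R
  set L := ∫ x, Real.exp (-(s * x)) ∂ν
  set u := ∫ x, Real.exp (-(s * x)) ∂μ
  have hL : 0 ≤ L := integral_nonneg fun x => (Real.exp_pos _).le
  have hu0 : 0 ≤ u := integral_nonneg fun x => (Real.exp_pos _).le
  have hu : u ≤ 1 - s + s ^ 2 / 2 * m := by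
    have : u ≤ ∫ x, (1 - s * x + s ^ 2 / 2 * x ^ 2) ∂μ := by
      refine integral_mono_ae iμ ((((integrable_const _).sub (i1.const_mul s)).add (i2.const_mul _))) ?_
      filter_upwards [h1] with x hx
      have hsx : 0 < s * x := by positivity
      have := Real.quadratic_le_exp_of_nonneg hsx.le
      simp only [Real.exp_neg]
      rw [inv_le_comm₀ (Real.exp_pos _)]
      · refine le_trans ?_ this
        rw [inv_le_iff_one_le_mul₀]
        · nlinarith [sq_nonneg (s*x), mul_pos hsx hsx, mul_pos (mul_pos hsx hsx) (mul_pos hsx hsx)]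
        · nlinarith [sq_nonneg (s * x - 1)]
      · nlinarith [sq_nonneg (s * x - 1)]
    have i0 : Integrable (fun x : ℝ => 1 - s * x) μ := (integrable_const _).sub (i1.const_mul s)
    rw [integral_add i0 (i2.const_mul _),
      integral_sub (integrable_const _) (i1.const_mul s), integral_const_mul, integral_const_mul,
      e1, e2] at this
    simpa using this
  simp only [mul_zero, neg_zero, Real.exp_zero, mul_one] at R
  have h5 : u ≤ 1 - s / 2 := by nlinarith
  rw [le_div_iff₀ hs]
  have h6 : q * u ≤ u := by nlinarith
  have h7 : L * (1 - q * u) = p := by linarith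
  nlinarith [mul_le_mul_of_nonneg_left (by linarith : s / 2 ≤ 1 - q * u) hL]

lemma aux_conc {μ ν : Measure ℝ} [IsProbabilityMeasure μ] [IsProbabilityMeasure ν]
    {p q m : ℝ} (hp : 0 < p) (hq : 0 ≤ q) (hpq : p + q = 1)
    (hμ : μ (Iic 0) = 0) (hν : ν (Iio 0) = 0)
    (hren : ν = ENNReal.ofReal p • Measure.dirac 0 + ENNReal.ofReal q • (μ.conv ν))
    (i1 : Integrable (fun x => x) μ) (e1 : ∫ x, x ∂μ = 1)
    (i2 : Integrable (fun x => x ^ 2) μ) (e2 : ∫ x, x ^ 2 ∂μ = m)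
    (y : ℝ) (hy : 0 < y) (x : ℝ) :
    ν.real (Ioc (x - y) x) ≤ 2 * Real.exp 1 * p * (y + m) := by
  have hm : 0 ≤ m := by rw [← e2]; exact integral_nonneg fun x => sq_nonneg x
  have h2 : ∀ᵐ x ∂ν, 0 ≤ x := by
    rw [ae_iff]; simpa [Iio] using hν
  have hB : ν.real (Iic y) ≤ 2 * Real.exp 1 * p * (y + m) := by
    have hs : 0 < (y + m)⁻¹ := by positivity
    have L := aux_laplace hp hq hpq hμ hν hren i1 e1 i2 e2 hs (by
      rw [inv_mul_le_iff₀ (by positivity)]; linarith)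
    rw [div_inv_eq_mul] at L
    have : ν.real (Iic y) ≤ ∫ x, Real.exp 1 * Real.exp (-((y + m)⁻¹ * x)) ∂ν := by
      rw [← integral_indicator_one measurableSet_Iic]
      refine integral_mono_ae ((integrable_const (1:ℝ)).indicator measurableSet_Iic) ?_ ?_
      · refine (Integrable.of_bound (by fun_prop) 1 (h2.mono fun x hx => ?_)).const_mul _
        rw [Real.norm_eq_abs, abs_of_pos (Real.exp_pos _), Real.exp_le_one_iff]
        have := mul_nonneg hs.le hx
        linarith
      · refine Filter.Eventually.of_forall fun x => ?_
        by_cases hx : x ≤ y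
        · simp only [indicator, mem_Iic, hx, if_true, ← Real.exp_add, Pi.one_apply]
          apply Real.one_le_exp
          have : (y + m)⁻¹ * x ≤ 1 := by
            rw [inv_mul_le_iff₀ (by positivity)]; linarith
          linarith
        · simp only [indicator, mem_Iic, hx, if_false]
          positivity
    rw [integral_const_mul] at this
    have := mul_le_mul_of_nonneg_left L (Real.exp_pos 1).le
    linarith
  refine le_trans ?_ hB
  set g : ℝ → ℝ := fun x => ν.real (Ioc (x - y) x)
  have hg1 : ∀ x, g x ≤ 1 := fun x => measureReal_le_one
  have hbdd : BddAbove (range g) := ⟨1, by rintro _ ⟨x, rfl⟩; exact hg1 x⟩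
  set S := ⨆ x, g x
  have hgS : ∀ x, g x ≤ S := fun x => le_ciSup hbdd x
  have hg : ∀ x, g x ≤ max (ν.real (Iic y)) (q * S) := by
    intro x
    rcases le_or_gt x y with hxy | hxy
    · exact le_max_of_le_left (measureReal_mono (fun z hz => hz.2.trans hxy))
    · apply le_max_of_le_right
      have hms : MeasurableSet (Ioc (x - y) x) := measurableSet_Ioc
      have ic : Integrable ((Ioc (x - y) x).indicator (1 : ℝ → ℝ)) (μ.conv ν) :=
        (integrable_const (1:ℝ)).indicator hms
      have R := aux_ren_int hp.le hq hren ic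
      rw [integral_indicator_one hms, integral_conv ic] at R
      have h0 : (Ioc (x - y) x).indicator (1 : ℝ → ℝ) 0 = 0 := by
        rw [indicator_of_notMem]; rintro ⟨h, _⟩; linarith
      rw [h0, mul_zero, zero_add] at R
      change ν.real (Ioc (x - y) x) ≤ _
      rw [R]
      refine mul_le_mul_of_nonneg_left ?_ hq
      have : ∀ a, ∫ b, (Ioc (x - y) x).indicator (1 : ℝ → ℝ) (a + b) ∂ν = g (x - a) := by
        intro a
        change _ = ν.real (Ioc (x - a - y) (x - a))
        rw [← integral_indicator_one measurableSet_Ioc]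
        congr 1; ext b
        have : a + b ∈ Ioc (x - y) x ↔ b ∈ Ioc (x - a - y) (x - a) := by
          simp only [mem_Ioc]
          constructor <;> rintro ⟨h, h'⟩ <;> constructor <;> linarith
        simp only [indicator, this, Pi.one_apply]
      simp only [this]
      calc ∫ a, g (x - a) ∂μ ≤ ∫ a, S ∂μ := by
            apply integral_mono_of_nonneg (Filter.Eventually.of_forall fun a => measureReal_nonneg)
              (integrable_const _) (Filter.Eventually.of_forall fun a => hgS _)
        _ = S := by simp
  have hS : S ≤ max (ν.real (Iic y)) (q * S) := ciSup_le hg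
  have hBn : 0 ≤ ν.real (Iic y) := measureReal_nonneg
  refine (hgS x).trans ?_
  rcases le_max_iff.1 hS with h | h
  · exact h
  · nlinarith

lemma aux_renewal_rate {μ ν : Measure ℝ} [IsProbabilityMeasure μ] [IsProbabilityMeasure ν]
    {p q m : ℝ} (hp : 0 < p) (hq : 0 ≤ q) (hpq : p + q = 1)
    (hμ : μ (Iic 0) = 0) (hν : ν (Iio 0) = 0)
    (hren : ν = ENNReal.ofReal p • Measure.dirac 0 + ENNReal.ofReal q • (μ.conv ν))
    (i1 : Integrable (fun x => x) μ) (e1 : ∫ x, x ∂μ = 1)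
    (i2 : Integrable (fun x => x ^ 2) μ) (e2 : ∫ x, x ^ 2 ∂μ = m)
    (x : ℝ) (hx : 0 ≤ x) :
    |(μ.conv ν).real (Iic x) - (1 - Real.exp (-(p * x)))| ≤ (1 + 4 * Real.exp 1 * m) * p := by
  have hm : 0 ≤ m := by rw [← e2]; exact integral_nonneg fun x => sq_nonneg x
  have h1 : ∀ᵐ x ∂μ, 0 < x := by
    rw [ae_iff]; simpa [Iic] using hμ
  have h2 : ∀ᵐ x ∂ν, 0 ≤ x := by
    rw [ae_iff]; simpa [Iio] using hν
  set W := μ.conv ν with hW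
  have h3 : ∀ᵐ x ∂W, 0 < x := by
    rw [ae_iff]; simpa [Iic] using aux_conv_nonneg hμ hν
  set A := 4 * Real.exp 1 * m * p with hA
  have hA0 : 0 ≤ A := by positivity
  have bd : ∀ x z : ℝ, 0 ≤ z → ‖max (x - z) 0‖ ≤ |x| := fun x z hz => by
    rw [Real.norm_eq_abs, abs_of_nonneg (le_max_right _ _)]
    exact max_le (by linarith [le_abs_self x]) (abs_nonneg _)
  have iW : ∀ x : ℝ, Integrable (fun w => max (x - w) 0) W := fun x =>
    Integrable.of_bound (by fun_prop) |x| (h3.mono fun z hz => bd x z hz.le)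
  have iν : ∀ x : ℝ, Integrable (fun w => max (x - w) 0) ν := fun x =>
    Integrable.of_bound (by fun_prop) |x| (h2.mono fun z hz => bd x z hz)
  set K : ℝ → ℝ := fun x => p * (x - ∫ w, max (x - w) 0 ∂W) with hK
  set G : ℝ → ℝ := fun x => 1 - W.real (Iic x) with hG
  have ind : ∀ x : ℝ, W.real (Iic x) = ∫ w, (Iic x).indicator (1 : ℝ → ℝ) w ∂W := fun x =>
    (integral_indicator_one measurableSet_Iic).symm
  have iind : ∀ (x : ℝ) (ρ : Measure ℝ) [IsProbabilityMeasure ρ],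
      Integrable ((Iic x).indicator (1 : ℝ → ℝ)) ρ := fun x ρ _ =>
    (integrable_const (1:ℝ)).indicator measurableSet_Iic
  have hK0 : K 0 = 0 := by
    have : ∫ w, max (0 - w) 0 ∂W = 0 := by
      rw [integral_eq_zero_of_ae]
      filter_upwards [h3] with w hw
      simp [hw.le]
    simp only [hK, this]; ring
  have k1 : ∀ a b, 0 ≤ a → a ≤ b → p * (b - a) * G b ≤ K b - K a := by
    intro a b ha hab
    have : (∫ w, max (b - w) 0 ∂W) - ∫ w, max (a - w) 0 ∂W ≤ (b - a) * W.real (Iic b) := by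
      rw [ind, ← integral_sub (iW b) (iW a), ← integral_const_mul]
      refine integral_mono ((iW b).sub (iW a)) ((iind b W).const_mul _) fun w => ?_
      by_cases hw : w ≤ b
      · simp only [indicator, mem_Iic, hw, if_true, Pi.one_apply]
        rw [max_eq_left (by linarith)]
        linarith [le_max_left (a - w) 0]
      · simp only [indicator, mem_Iic, hw, if_false]
        rw [max_eq_right (by linarith), max_eq_right (by linarith)]
        simp
    have := mul_le_mul_of_nonneg_left this hp.le
    simp only [hK, hG]
    linarith
  have k2 : ∀ a b, 0 ≤ a → a ≤ b → K b - K a ≤ p * (b - a) * G a := by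
    intro a b ha hab
    have : (b - a) * W.real (Iic a) ≤ (∫ w, max (b - w) 0 ∂W) - ∫ w, max (a - w) 0 ∂W := by
      rw [ind, ← integral_sub (iW b) (iW a), ← integral_const_mul]
      refine integral_mono ((iind a W).const_mul _) ((iW b).sub (iW a)) fun w => ?_
      by_cases hw : w ≤ a
      · simp only [indicator, mem_Iic, hw, if_true, Pi.one_apply]
        rw [max_eq_left (by linarith), max_eq_left (by linarith)]
        linarith
      · simp only [indicator, mem_Iic, hw, if_false]
        rw [max_eq_right (by linarith : a - w ≤ 0)]
        simp
    have := mul_le_mul_of_nonneg_left this hp.le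
    simp only [hK, hG]
    linarith
  -- the key identity
  have key : ∀ x, 0 ≤ x → 0 ≤ 1 - K x - G x + p * G x ∧ 1 - K x - G x + p * G x ≤ A := by
    intro x hx
    have R1 := aux_ren_int hp.le hq hren (iW x)
    have R2 := aux_ren_int hp.le hq hren (iind x (μ.conv ν))
    rw [integral_indicator_one measurableSet_Iic, integral_indicator_one measurableSet_Iic] at R2
    rw [← hW] at R1 R2
    have h0 : (Iic x).indicator (1 : ℝ → ℝ) 0 = 1 := by simp [hx]
    rw [h0] at R2
    rw [sub_zero, max_eq_left hx] at R1
    set I0 := ∫ w, max (x - w) 0 ∂ν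
    set I1 := ∫ w, max (x - w) 0 ∂W with hI1
    have id1 : 1 - K x - G x + p * G x = ν.real (Iic x) - (I0 - I1) := by
      simp only [hK, hG]
      rw [R1, R2, ← hI1]
      have : q = 1 - p := by linarith
      rw [this]; ring
    rw [id1]
    set F : ℝ → ℝ → ℝ := fun y z => y * (Iic x).indicator (1 : ℝ → ℝ) z - max (x - z) 0 +
      max (x - (y + z)) 0 with hF
    have iconv : Integrable (fun pz : ℝ × ℝ => max (x - (pz.1 + pz.2)) 0) (μ.prod ν) := by
      have := iW x
      rw [hW, Measure.conv] at this
      exact this.comp_measurable (by fun_prop)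
    have ip1 : Integrable (fun pz : ℝ × ℝ => pz.1 * (Iic x).indicator (1 : ℝ → ℝ) pz.2)
        (μ.prod ν) := i1.mul_prod (iind x ν)
    have ip2 : Integrable (fun pz : ℝ × ℝ => max (x - pz.2) 0) (μ.prod ν) := (iν x).comp_snd μ
    have iF : Integrable (fun pz : ℝ × ℝ => F pz.1 pz.2) (μ.prod ν) := (ip1.sub ip2).add iconv
    have id2 : ν.real (Iic x) - (I0 - I1) = ∫ y, ∫ z, F y z ∂ν ∂μ := by
      rw [integral_integral iF]
      have ip12 : Integrable (fun pz : ℝ × ℝ => pz.1 * (Iic x).indicator (1 : ℝ → ℝ) pz.2 -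
        max (x - pz.2) 0) (μ.prod ν) := ip1.sub ip2
      simp only [hF]
      rw [integral_add ip12 iconv, integral_sub ip1 ip2,
        integral_prod_mul (fun y => y) ((Iic x).indicator (1 : ℝ → ℝ)),
        integral_indicator_one measurableSet_Iic, e1, integral_prod _ ip2,
        integral_prod _ iconv, hI1, hW, integral_conv (iW x)]
      simp
      ring
    rw [id2]
    have F0 : ∀ y z, 0 < y → 0 ≤ F y z ∧ F y z ≤ y * (Ioc (x - y) x).indicator (1 : ℝ → ℝ) z := by
      intro y z hy
      simp only [hF]
      by_cases hz : z ≤ x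
      · by_cases hz2 : x - y < z
        · simp only [indicator, mem_Iic, mem_Ioc, hz, hz2, and_self, if_true, Pi.one_apply]
          rw [max_eq_left (by linarith), max_eq_right (by linarith)]
          constructor <;> linarith
        · simp only [indicator, mem_Iic, mem_Ioc, hz, hz2, false_and, if_true, if_false,
            Pi.one_apply]
          rw [max_eq_left (by linarith), max_eq_left (by linarith)]
          constructor <;> linarith
      · simp only [indicator, mem_Iic, mem_Ioc, hz, and_false, if_false]
        rw [max_eq_right (by linarith), max_eq_right (by linarith)]
        simp
    constructor
    · apply integral_nonneg_of_ae
      filter_upwards [h1] with y hy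
      exact integral_nonneg fun z => (F0 y z hy).1
    · have ib : Integrable (fun y => 2 * Real.exp 1 * p * (y ^ 2 + m * y)) μ :=
        (i2.add (i1.const_mul m)).const_mul _
      calc ∫ y, ∫ z, F y z ∂ν ∂μ ≤ ∫ y, 2 * Real.exp 1 * p * (y ^ 2 + m * y) ∂μ := by
            refine integral_mono_ae iF.integral_prod_left ib ?_
            filter_upwards [h1, iF.prod_right_ae] with y hy hiy
            calc ∫ z, F y z ∂ν ≤ ∫ z, y * (Ioc (x - y) x).indicator (1 : ℝ → ℝ) z ∂ν :=
                  integral_mono hiy (((integrable_const (1:ℝ)).indicator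
                    measurableSet_Ioc).const_mul y) fun z => (F0 y z hy).2
              _ = y * ν.real (Ioc (x - y) x) := by
                  rw [integral_const_mul, integral_indicator_one measurableSet_Ioc]
              _ ≤ y * (2 * Real.exp 1 * p * (y + m)) :=
                  mul_le_mul_of_nonneg_left
                    (aux_conc hp hq hpq hμ hν hren i1 e1 i2 e2 y hy x) hy.le
              _ = _ := by ring
        _ = A := by
            rw [integral_const_mul, integral_add i2 (i1.const_mul m), integral_const_mul, e1, e2, hA]
            ring
  have hG0 : ∀ x, 0 ≤ G x := fun x => by
    simp only [hG]; linarith [measureReal_le_one (μ := W) (s := Iic x)]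
  have hG1 : ∀ x, G x ≤ 1 := fun x => by
    simp only [hG]; linarith [measureReal_nonneg (μ := W) (s := Iic x)]
  obtain ⟨c1, c2⟩ := aux_compare K G p A hp hK0 k1 k2
    (fun x hx => by nlinarith [(key x hx).1, hG1 x])
    (fun x hx => by nlinarith [(key x hx).2, hG0 x]) x hx
  obtain ⟨c3, c4⟩ := key x hx
  have hx1 : Real.exp (-(p * x)) ≤ 1 := Real.exp_le_one_iff.2 (by nlinarith)
  have hx0 := Real.exp_pos (-(p * x))
  have hWG : W.real (Iic x) = 1 - G x := by simp only [hG]; ring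
  have g1 : p * G x ≤ p := by nlinarith [hG1 x]
  have g0 : 0 ≤ p * G x := mul_nonneg hp.le (hG0 x)
  have a0 : 0 ≤ A * Real.exp (-(p * x)) := by positivity
  have a1 : 0 ≤ p * Real.exp (-(p * x)) := by positivity
  have hC : (1 + 4 * Real.exp 1 * m) * p = p + A := by rw [hA]; ring
  rw [hC, hWG, abs_le]
  constructor <;> linarith

lemma aux_cutoff : ∃ χ : ℕ → ℝ → ℝ, (∀ k, ContDiff ℝ (⊤ : ℕ∞) (χ k)) ∧
    (∀ k, HasCompactSupport (χ k)) ∧ (∀ k, tsupport (χ k) ⊆ Ioi 0) ∧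
    (∀ k x, |χ k x| ≤ 1) ∧ (∀ x, 0 < x → ∀ᶠ k in Filter.atTop, χ k x = 1) := by
  have hpos : ∀ k : ℕ, (0 : ℝ) < 1 / ((k : ℝ) + 2) := fun k => by positivity
  have hle : ∀ k : ℕ, 1 / ((k : ℝ) + 2) ≤ 1 / 2 := fun k =>
    one_div_le_one_div_of_le (by norm_num) (by linarith [(Nat.cast_nonneg k : (0:ℝ) ≤ k)])
  let b : ∀ k : ℕ, ContDiffBump ((k : ℝ) + 2) := fun k =>
    { rIn := k + 2 - 1 / ((k : ℝ) + 2)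
      rOut := k + 2 - (1 / ((k : ℝ) + 2)) / 2
      rIn_pos := by linarith [hle k, (Nat.cast_nonneg k : (0:ℝ) ≤ k)]
      rIn_lt_rOut := by linarith [hpos k] }
  refine ⟨fun k => b k, fun k => (b k).contDiff, fun k => (b k).hasCompactSupport, ?_, ?_, ?_⟩
  · intro k x hx
    rw [(b k).tsupport_eq, Metric.mem_closedBall, Real.dist_eq] at hx
    have := (abs_le.1 hx).1
    have hr : (b k).rOut = k + 2 - (1 / ((k : ℝ) + 2)) / 2 := rfl
    rw [hr] at this
    have := hpos k
    simp only [mem_Ioi]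
    linarith
  · intro k x
    rw [abs_of_nonneg (b k).nonneg]
    exact (b k).le_one
  · intro x hx
    filter_upwards [Filter.eventually_ge_atTop (⌈x⌉₊), Filter.eventually_ge_atTop (⌈1 / x⌉₊)]
      with k hk1 hk2
    have h1 : x ≤ k := (Nat.le_ceil _).trans (by exact_mod_cast hk1)
    have h2 : 1 / x ≤ k := (Nat.le_ceil _).trans (by exact_mod_cast hk2)
    have h3 : 1 / ((k : ℝ) + 2) ≤ x := by
      rw [div_le_iff₀ (by positivity)]
      rw [div_le_iff₀ hx] at h2
      nlinarith
    apply (b k).one_of_mem_closedBall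
    rw [Metric.mem_closedBall, Real.dist_eq, abs_le]
    have hr : (b k).rIn = k + 2 - 1 / ((k : ℝ) + 2) := rfl
    rw [hr]
    have := hle k
    constructor <;> linarith

lemma aux_bound {ρ : Measure ℝ} [IsFiniteMeasure ρ] (f : ℝ → ℝ) (hf : ∀ x, |f x| ≤ 1) :
    |∫ x, f x ∂ρ| ≤ ρ.real univ := by
  have := norm_integral_le_of_norm_le_const (μ := ρ) (f := f) (C := 1)
    (Filter.Eventually.of_forall hf)
  simpa using this

lemma aux_conv_univ (ρ : Measure ℝ) [IsFiniteMeasure ρ] :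
    (ρ.conv ρ).real univ = ρ.real univ * ρ.real univ := by
  rw [measureReal_def, Measure.conv, Measure.map_apply (by fun_prop) MeasurableSet.univ]
  rw [preimage_univ, ← univ_prod_univ, Measure.prod_prod, ENNReal.toReal_mul]
  rfl

/-- the reduced right-hand side for kernel 2 -/
noncomputable def auxT (n : ℝ → Measure ℝ) (f : ℝ → ℝ) (t : ℝ) : ℝ :=
  (∫ x, f x ∂((n t).conv (n t))) - 2 * (n t).real univ * ∫ x, f x ∂(n t)

lemma auxT_bound (n : ℝ → Measure ℝ) (f : ℝ → ℝ) (t : ℝ) [IsFiniteMeasure (n t)]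
    (hN : (n t).real univ ≤ 1) (hf : ∀ x, |f x| ≤ 1) : |auxT n f t| ≤ 3 := by
  have h0 : 0 ≤ (n t).real univ := measureReal_nonneg
  have a := aux_bound (ρ := (n t).conv (n t)) f hf
  have b := aux_bound (ρ := n t) f hf
  rw [aux_conv_univ] at a
  have c : |2 * (n t).real univ * ∫ x, f x ∂(n t)| ≤ 2 := by
    rw [abs_mul, abs_of_nonneg (by positivity)]
    nlinarith
  unfold auxT
  have := abs_sub (∫ x, f x ∂((n t).conv (n t))) (2 * (n t).real univ * ∫ x, f x ∂(n t))
  nlinarith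

lemma auxT_eq (n : ℝ → Measure ℝ) (f : ℝ → ℝ) (t : ℝ) [IsFiniteMeasure (n t)]
    (hfc : Continuous f) (hf : ∀ x, |f x| ≤ 1) :
    (1 / 2) * ∫ x, ∫ y, (f (x + y) - f x - f y) * 2 ∂(n t) ∂(n t) = auxT n f t := by
  have i : ∀ (ρ : Measure ℝ) [IsFiniteMeasure ρ], Integrable f ρ := fun ρ _ =>
    Integrable.of_bound hfc.aestronglyMeasurable 1 (Filter.Eventually.of_forall hf)
  have i2 : ∀ x, Integrable (fun y => f (x + y)) (n t) := fun x =>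
    Integrable.of_bound (by fun_prop) 1 (Filter.Eventually.of_forall fun y => hf _)
  have i3 : Integrable (fun x => ∫ y, f (x + y) ∂(n t)) (n t) := by
    have h : Integrable (fun p : ℝ × ℝ => f (p.1 + p.2)) ((n t).prod (n t)) :=
      Integrable.of_bound (by fun_prop) 1 (Filter.Eventually.of_forall fun y => hf _)
    exact h.integral_prod_left
  have e : ∀ x, ∫ y, (f (x + y) - f x - f y) * 2 ∂(n t) =
      2 * ((∫ y, f (x + y) ∂(n t)) - (n t).real univ * f x - ∫ y, f y ∂(n t)) := by
    intro x
    have i4 : Integrable (fun y => f (x + y) - f x) (n t) := (i2 x).sub (integrable_const _)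
    rw [integral_mul_const, integral_sub i4 (i _), integral_sub (i2 x) (integrable_const _)]
    simp
    ring
  simp only [e]
  have i5 : Integrable (fun x => (∫ y, f (x + y) ∂(n t)) - (n t).real univ * f x) (n t) :=
    i3.sub ((i _).const_mul _)
  rw [integral_const_mul, integral_sub i5 (integrable_const _), integral_sub i3 ((i _).const_mul _),
    integral_const_mul]
  unfold auxT
  rw [integral_conv (i _)]
  simp
  ring

lemma aux_weak (n : ℝ → Measure ℝ) (hfin : ∀ t ∈ Ici (1:ℝ), IsFiniteMeasure (n t))
    (hpos : ∀ t ∈ Ici (1:ℝ), n t (Iic 0) = 0)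
    (hN : ∀ t ∈ Ici (1:ℝ), (n t).real univ ≤ 1)
    (hw : ∀ φ : ℝ → ℝ, ContDiff ℝ (⊤ : ℕ∞) φ → HasCompactSupport φ → tsupport φ ⊆ Ioi 0 →
      ∀ t ∈ Ici (1:ℝ), HasDerivWithinAt (fun r => ∫ x, φ x ∂(n r))
      ((1 / 2) * ∫ x, ∫ y, (φ (x + y) - φ x - φ y) * 2 ∂(n t) ∂(n t)) (Ici 1) t)
    (f : ℝ → ℝ) (hfs : ContDiff ℝ (⊤ : ℕ∞) f) (hf : ∀ x, |f x| ≤ 1) :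
    ContinuousOn (fun r => ∫ x, f x ∂(n r)) (Ici 1) ∧
    ∀ t, 1 ≤ t → IntervalIntegrable (auxT n f) volume 1 t ∧
      ∫ s in (1:ℝ)..t, auxT n f s = (∫ x, f x ∂(n t)) - ∫ x, f x ∂(n 1) := by
  obtain ⟨χ, c1, c2, c3, c4, c5⟩ := aux_cutoff
  set φ : ℕ → ℝ → ℝ := fun k x => χ k x * f x with hφ
  have φs : ∀ k, ContDiff ℝ (⊤ : ℕ∞) (φ k) := fun k => (c1 k).mul hfs
  have φc : ∀ k, HasCompactSupport (φ k) := fun k => (c2 k).mul_right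
  have φt : ∀ k, tsupport (φ k) ⊆ Ioi 0 := fun k =>
    (tsupport_mul_subset_left).trans (c3 k)
  have φb : ∀ k x, |φ k x| ≤ 1 := fun k x => by
    simp only [hφ, abs_mul]
    exact mul_le_one₀ (c4 k x) (abs_nonneg _) (hf x)
  have φl : ∀ x, 0 < x → Filter.Tendsto (fun k => φ k x) Filter.atTop (nhds (f x)) := by
    intro x hx
    refine tendsto_const_nhds.congr' ?_
    filter_upwards [c5 x hx] with k hk
    simp [hφ, hk]
  have φd : ∀ k, ∀ t ∈ Ici (1:ℝ), HasDerivWithinAt (fun r => ∫ x, φ k x ∂(n r))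
      (auxT n (φ k) t) (Ici 1) t := by
    intro k t ht
    have := hfin t ht
    have := hw (φ k) (φs k) (φc k) (φt k) t ht
    rwa [auxT_eq n (φ k) t (φs k).continuous (φb k)] at this
  have lim : ∀ (ρ : Measure ℝ) [IsFiniteMeasure ρ], ρ (Iic 0) = 0 →
      Filter.Tendsto (fun k => ∫ x, φ k x ∂ρ) Filter.atTop (nhds (∫ x, f x ∂ρ)) := by
    intro ρ _ h0
    have h1 : ∀ᵐ x ∂ρ, 0 < x := by
      rw [ae_iff]; simpa [Iic] using h0
    refine tendsto_integral_of_dominated_convergence (fun _ => 1)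
      (fun k => (φs k).continuous.aestronglyMeasurable) (integrable_const _)
      (fun k => Filter.Eventually.of_forall (φb k)) (h1.mono fun x hx => φl x hx)
  have limu : ∀ t ∈ Ici (1:ℝ), Filter.Tendsto (fun k => ∫ x, φ k x ∂(n t)) Filter.atTop
      (nhds (∫ x, f x ∂(n t))) := fun t ht => by
    have := hfin t ht
    exact lim _ (hpos t ht)
  have limT : ∀ t ∈ Ici (1:ℝ), Filter.Tendsto (fun k => auxT n (φ k) t) Filter.atTop
      (nhds (auxT n f t)) := fun t ht => by
    have := hfin t ht
    have hIio : n t (Iio 0) = 0 := measure_mono_null Iio_subset_Iic_self (hpos t ht)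
    exact (lim _ (aux_conv_nonneg (hpos t ht) hIio)).sub ((limu t ht).const_mul _)
  have bT : ∀ k, ∀ t ∈ Ici (1:ℝ), |auxT n (φ k) t| ≤ 3 := fun k t ht => by
    have := hfin t ht
    exact auxT_bound n _ t (hN t ht) (φb k)
  have lip : ∀ s ∈ Ici (1:ℝ), ∀ t ∈ Ici (1:ℝ),
      |(∫ x, f x ∂(n t)) - ∫ x, f x ∂(n s)| ≤ 3 * |t - s| := by
    intro s hs t ht
    refine le_of_tendsto ((limu t ht).sub (limu s hs)).abs (Filter.Eventually.of_forall fun k => ?_)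
    exact (convex_Ici 1).norm_image_sub_le_of_norm_hasDerivWithin_le (φd k) (bT k) hs ht
  refine ⟨?_, fun t ht => ?_⟩
  · refine LipschitzOnWith.continuousOn (K := 3) (LipschitzOnWith.of_dist_le_mul ?_)
    intro a ha b hb
    exact lip b hb a ha
  · have meas : ∀ k, AEStronglyMeasurable (auxT n (φ k)) (volume.restrict (Ioc 1 t)) := by
      intro k
      refine AEStronglyMeasurable.congr
        (stronglyMeasurable_deriv (fun r => ∫ x, φ k x ∂(n r))).aestronglyMeasurable ?_
      refine (ae_restrict_mem measurableSet_Ioc).mono fun s hs => ?_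
      exact ((φd k s hs.1.le).hasDerivAt (Ici_mem_nhds hs.1)).deriv
    have mem : ∀ᵐ s ∂(volume.restrict (Ioc 1 t)), s ∈ Ici (1:ℝ) :=
      (ae_restrict_mem measurableSet_Ioc).mono fun s hs => hs.1.le
    have measf : AEStronglyMeasurable (auxT n f) (volume.restrict (Ioc 1 t)) :=
      aestronglyMeasurable_of_tendsto_ae Filter.atTop meas (mem.mono fun s hs => limT s hs)
    have ii : ∀ g : ℝ → ℝ, AEStronglyMeasurable g (volume.restrict (Ioc 1 t)) →
        (∀ s ∈ Ici (1:ℝ), |g s| ≤ 3) → IntervalIntegrable g volume 1 t := by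
      intro g hg hb
      rw [intervalIntegrable_iff_integrableOn_Ioc_of_le ht]
      exact Integrable.of_bound hg 3 (mem.mono fun s hs => hb s hs)
    refine ⟨ii _ measf fun s hs => ?_, ?_⟩
    · have := hfin s hs
      exact auxT_bound n _ s (hN s hs) hf
    · have hk : ∀ k, ∫ s in (1:ℝ)..t, auxT n (φ k) s =
          (∫ x, φ k x ∂(n t)) - ∫ x, φ k x ∂(n 1) := by
        intro k
        refine intervalIntegral.integral_eq_sub_of_hasDeriv_right_of_le
          (f := fun r => ∫ x, φ k x ∂(n r)) ht ?_ ?_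
          (ii _ (meas k) (bT k))
        · intro s hs
          exact ((φd k s hs.1).continuousWithinAt).mono Icc_subset_Ici_self
        · intro s hs
          exact ((φd k s hs.1.le).hasDerivAt (Ici_mem_nhds hs.1)).hasDerivWithinAt
      have l1 : Filter.Tendsto (fun k => ∫ s in (1:ℝ)..t, auxT n (φ k) s) Filter.atTop
          (nhds (∫ s in (1:ℝ)..t, auxT n f s)) := by
        refine intervalIntegral.tendsto_integral_filter_of_dominated_convergence (fun _ => 3)
          ?_ ?_ (by simp) ?_
        · rw [uIoc_of_le ht]
          exact Filter.Eventually.of_forall meas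
        · refine Filter.Eventually.of_forall fun k => Filter.Eventually.of_forall fun s hs => ?_
          rw [uIoc_of_le ht] at hs
          exact bT k s hs.1.le
        · refine Filter.Eventually.of_forall fun s hs => ?_
          rw [uIoc_of_le ht] at hs
          exact limT s hs.1.le
      simp only [hk] at l1
      exact tendsto_nhds_unique l1 ((limu t ht).sub (limu 1 (by simp)))

lemma aux_N (N : ℝ → ℝ) (h1 : N 1 = 1)
    (hd : ∀ t ∈ Ici (1:ℝ), HasDerivWithinAt N (-(N t * N t)) (Ici 1) t) (t : ℝ) (ht : 1 ≤ t) :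
    N t * t = 1 := by
  have hc : ContinuousOn N (Icc 1 t) := fun s hs =>
    ((hd s hs.1).continuousWithinAt).mono Icc_subset_Ici_self
  obtain ⟨B, hB⟩ := isCompact_Icc.exists_bound_of_continuousOn hc
  have := eq_zero_of_abs_deriv_le_mul_abs_self_of_eq_zero_right (f := fun s => N s * s - 1)
    (f' := fun s => -(N s) * (N s * s - 1)) (K := B) (a := 1) (b := t)
    ((hc.mul continuousOn_id).sub continuousOn_const) (fun s hs => by
      have h := (((hd s hs.1).mono (Ici_subset_Ici.2 hs.1)).mul
        (hasDerivWithinAt_id s (Ici s))).sub_const 1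
      refine h.congr_deriv ?_
      simp only [id]
      ring) (by simp [h1]) (fun s hs => by
      rw [norm_mul, norm_neg]
      exact mul_le_mul_of_nonneg_right (hB s ⟨hs.1, hs.2.le⟩) (norm_nonneg _)) t ⟨ht, le_rfl⟩
  linarith

lemma aux_charFun_decomp (ρ : Measure ℝ) [IsFiniteMeasure ρ] (ξ : ℝ) :
    charFun ρ ξ = ((∫ x, Real.cos (ξ * x) ∂ρ : ℝ) : ℂ) +
      ((∫ x, Real.sin (ξ * x) ∂ρ : ℝ) : ℂ) * Complex.I := by
  have ic : Integrable (fun x => ((Real.cos (ξ * x) : ℝ) : ℂ)) ρ :=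
    Integrable.of_bound (by fun_prop) 1 (Filter.Eventually.of_forall fun x => by
      rw [Complex.norm_real]; exact Real.abs_cos_le_one _)
  have is : Integrable (fun x => ((Real.sin (ξ * x) : ℝ) : ℂ) * Complex.I) ρ :=
    Integrable.of_bound (by fun_prop) 1 (Filter.Eventually.of_forall fun x => by
      rw [norm_mul, Complex.norm_real, Complex.norm_I, mul_one]; exact Real.abs_sin_le_one _)
  rw [charFun_apply_real, ← integral_complex_ofReal, ← integral_complex_ofReal,
    ← integral_mul_const, ← integral_add ic is]
  congr 1; ext x
  rw [Complex.exp_mul_I]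
  push_cast
  rfl

lemma aux_charFun_ode (u : ℝ → ℂ) (hc : ContinuousOn u (Ici 1))
    (hb : ∀ t, 1 ≤ t → ‖u t‖ ≤ 1)
    (hi : ∀ t, 1 ≤ t → u t = u 1 + ∫ s in (1:ℝ)..t, (u s ^ 2 - 2 * (s : ℂ)⁻¹ * u s))
    (t : ℝ) (ht : 1 ≤ t) :
    (t : ℂ) ^ 2 * u t = u 1 + t * (t - 1) * u 1 * u t := by
  set g : ℝ → ℂ := fun s => u (max 1 s) ^ 2 - 2 * ((max 1 s : ℝ) : ℂ)⁻¹ * u (max 1 s) with hg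
  have hum : Continuous fun s : ℝ => u (max 1 s) :=
    hc.comp_continuous (by fun_prop) (fun s => le_max_left 1 s)
  have hgc : Continuous g := by
    have h0 : Continuous fun s : ℝ => ((max 1 s : ℝ) : ℂ)⁻¹ := by
      refine Continuous.inv₀ (by fun_prop) fun s => ?_
      have : (0:ℝ) < max 1 s := lt_of_lt_of_le one_pos (le_max_left _ _)
      exact_mod_cast this.ne'
    exact (hum.pow 2).sub ((continuous_const.mul h0).mul hum)
  set v : ℝ → ℂ := fun r => u 1 + ∫ s in (1:ℝ)..r, g s with hv
  have vd : ∀ r, HasDerivAt v (g r) r := fun r =>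
    (intervalIntegral.integral_hasDerivAt_right (hgc.intervalIntegrable _ _)
      (hgc.stronglyMeasurableAtFilter _ _) hgc.continuousAt).const_add _
  have vu : ∀ r, 1 ≤ r → v r = u r := by
    intro r hr
    rw [hi r hr]
    simp only [hv]
    congr 1
    apply intervalIntegral.integral_congr
    intro s hs
    rw [uIcc_of_le hr] at hs
    simp only [hg, max_eq_right hs.1]
  have vd' : ∀ r, 1 ≤ r → HasDerivAt v (v r ^ 2 - 2 * (r : ℂ)⁻¹ * v r) r := by
    intro r hr
    have := vd r
    simp only [hg, max_eq_right hr] at this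
    rwa [← vu r hr] at this
  have := eq_zero_of_abs_deriv_le_mul_abs_self_of_eq_zero_right
    (f := fun s : ℝ => (s : ℂ) ^ 2 * v s - u 1 - s * (s - 1) * u 1 * v s)
    (f' := fun s : ℝ => v s * ((s : ℂ) ^ 2 * v s - u 1 - s * (s - 1) * u 1 * v s))
    (K := 1) (a := 1) (b := t)
    (by
      have : Continuous v := continuous_iff_continuousAt.2 fun r => (vd r).continuousAt
      exact Continuous.continuousOn (by fun_prop)) (fun s hs => by
      have hs0 : (s : ℂ) ≠ 0 := by
        have : (0:ℝ) < s := lt_of_lt_of_le one_pos hs.1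
        exact_mod_cast this.ne'
      have hid : HasDerivAt (fun s : ℝ => (s : ℂ)) 1 s := Complex.ofRealCLM.hasDerivAt
      have h := (((hid.pow 2).mul (vd' s hs.1)).sub_const (u 1)).sub
        (((hid.mul (hid.sub_const 1)).mul_const (u 1)).mul (vd' s hs.1))
      refine (h.congr_deriv ?_).hasDerivWithinAt
      simp only [Pi.pow_apply, Pi.mul_apply]
      field_simp
      push_cast
      ring) (by simp [vu 1 le_rfl]) (fun s hs => by
      rw [norm_mul, vu s hs.1]
      exact mul_le_mul_of_nonneg_right (hb s hs.1) (norm_nonneg _)) t ⟨ht, le_rfl⟩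
  simp only [vu t ht] at this
  linear_combination this

lemma aux_charFun_add (ρ σ : Measure ℝ) [IsFiniteMeasure ρ] [IsFiniteMeasure σ] (ξ : ℝ) :
    charFun (ρ + σ) ξ = charFun ρ ξ + charFun σ ξ := by
  have i : ∀ (ρ : Measure ℝ) [IsFiniteMeasure ρ],
      Integrable (fun x : ℝ => Complex.exp (ξ * x * Complex.I)) ρ := fun ρ _ =>
    Integrable.of_bound (by fun_prop) 1 (Filter.Eventually.of_forall fun x => by
      rw [← Complex.ofReal_mul, Complex.norm_exp_ofReal_mul_I])
  simp only [charFun_apply_real]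
  exact integral_add_measure (i ρ) (i σ)

lemma aux_charFun_smul (ρ : Measure ℝ) {c : ℝ} (hc : 0 ≤ c) (ξ : ℝ) :
    charFun (ENNReal.ofReal c • ρ) ξ = c * charFun ρ ξ := by
  simp only [charFun_apply_real, integral_smul_measure, ENNReal.toReal_ofReal hc]
  simp


/-- Rate of convergence to self-similarity for Smoluchowski's equation with constant
kernel `K = 2`: if `n₀` has total mass `1`, first moment `1`, and finite second moment
`μ₂`, then the rescaled distribution function `F(τ,xh) = t·n(t,(0,txh])` (with `t = e^τ`)
satisfies `sup_{xh>0} |F(τ,xh) - (1 - e^{-xh})| ≤ C(μ₂)(1+τ)e^{-τ}` for all `τ ≥ 0`, where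
the constant `C` depends only on `μ₂`. -/
theorem constant_kernel_rate (μ2 : ℝ) :
    ∃ C : ℝ, ∀ (n0 : Measure ℝ) (n : ℝ → Measure ℝ),
      n0 (Iic 0) = 0 →
      n0 univ = 1 →
      Integrable (fun x => x) n0 → (∫ x, x ∂n0) = 1 →
      Integrable (fun x => x ^ 2) n0 → (∫ x, x ^ 2 ∂n0) = μ2 →
      IsWeakSolution (fun _ _ => 2) (Ici 1) n {0, 1, 2} →
      n 1 = n0 →
      ∀ τ ≥ (0 : ℝ), ∀ xh > (0 : ℝ),
        |Real.exp τ * ((n (Real.exp τ)) (Ioc 0 (Real.exp τ * xh))).toReal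
            - (1 - Real.exp (-xh))| ≤ C * (1 + τ) * Real.exp (-τ) := by
  refine ⟨1 + 4 * Real.exp 1 * μ2, ?_⟩
  intro n0 n h0 hmass i1 e1 i2 e2 hsol hn1 τ hτ xh hxh
  obtain ⟨hfin, hpos, hw, hmom⟩ := hsol
  have hprob0 : IsProbabilityMeasure n0 := ⟨hmass⟩
  have hm : 0 ≤ μ2 := by rw [← e2]; exact integral_nonneg fun x => sq_nonneg x
  -- total number
  have hNd : ∀ t ∈ Ici (1:ℝ), HasDerivWithinAt (fun r => (n r).real univ)
      (-((n t).real univ * (n t).real univ)) (Ici 1) t := by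
    intro t ht
    have := hfin t ht
    have h := hmom 0 (by simp)
      (fun s hs => by
        have := hfin s hs
        simp)
      (fun s hs => by
        have := hfin s hs
        simp only [pow_zero]
        exact integrable_const _) t ht
    simp only [pow_zero, integral_const, smul_eq_mul, mul_one] at h
    refine h.congr_deriv ?_
    rw [← univ_prod_univ, measureReal_prod_prod]
    ring
  have hN : ∀ t, 1 ≤ t → (n t).real univ * t = 1 := aux_N _ (by
    simp [hn1]) hNd
  have hN' : ∀ t, 1 ≤ t → (n t).real univ = t⁻¹ := fun t ht =>
    eq_inv_of_mul_eq_one_left (hN t ht)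
  have hN1 : ∀ t ∈ Ici (1:ℝ), (n t).real univ ≤ 1 := fun t ht => by
    rw [hN' t ht]; exact inv_le_one_of_one_le₀ ht
  -- characteristic functions
  have hchar : ∀ ξ t : ℝ, 1 ≤ t → (t : ℂ) ^ 2 * charFun (n t) ξ =
      charFun n0 ξ + t * (t - 1) * charFun n0 ξ * charFun (n t) ξ := by
    intro ξ t ht
    obtain ⟨cc, ci⟩ := aux_weak n hfin hpos hN1 hw (fun x => Real.cos (ξ * x))
      (by fun_prop) (fun x => Real.abs_cos_le_one _)
    obtain ⟨sc, si⟩ := aux_weak n hfin hpos hN1 hw (fun x => Real.sin (ξ * x))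
      (by fun_prop) (fun x => Real.abs_sin_le_one _)
    have dec : ∀ r, 1 ≤ r → charFun (n r) ξ = ((∫ x, Real.cos (ξ * x) ∂(n r) : ℝ) : ℂ) +
      ((∫ x, Real.sin (ξ * x) ∂(n r) : ℝ) : ℂ) * Complex.I := fun r hr => by
        have := hfin r hr
        exact aux_charFun_decomp _ _
    have := aux_charFun_ode (fun r => charFun (n r) ξ) (by
      refine ContinuousOn.congr (f := fun r => ((∫ x, Real.cos (ξ * x) ∂(n r) : ℝ) : ℂ) +
        ((∫ x, Real.sin (ξ * x) ∂(n r) : ℝ) : ℂ) * Complex.I) ?_ (fun r hr => dec r hr)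
      exact (Complex.continuous_ofReal.comp_continuousOn cc).add
        ((Complex.continuous_ofReal.comp_continuousOn sc).mul continuousOn_const))
      (fun r hr => (norm_charFun_le ξ).trans (hN1 r hr)) (fun r hr => by
        obtain ⟨ci1, ci2⟩ := ci r hr
        obtain ⟨si1, si2⟩ := si r hr
        have e : ∫ s in (1:ℝ)..r, (charFun (n s) ξ ^ 2 - 2 * (s : ℂ)⁻¹ * charFun (n s) ξ) =
            ∫ s in (1:ℝ)..r, (((auxT n (fun x => Real.cos (ξ * x)) s : ℝ) : ℂ) +
              ((auxT n (fun x => Real.sin (ξ * x)) s : ℝ) : ℂ) * Complex.I) := by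
          apply intervalIntegral.integral_congr
          intro s hs
          rw [uIcc_of_le hr] at hs
          have := hfin s hs.1
          have hcv := charFun_conv (μ := n s) (ν := n s) ξ
          rw [aux_charFun_decomp ((n s).conv (n s))] at hcv
          simp only [auxT]
          rw [sq, ← hcv, aux_charFun_decomp (n s), hN' s hs.1]
          push_cast
          ring
        have ci1' : IntervalIntegrable (fun s => ((auxT n (fun x => Real.cos (ξ * x)) s : ℝ) : ℂ))
            volume 1 r := ⟨ci1.1.ofReal, ci1.2.ofReal⟩
        have si1' : IntervalIntegrable (fun s => ((auxT n (fun x => Real.sin (ξ * x)) s : ℝ) : ℂ))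
            volume 1 r := ⟨si1.1.ofReal, si1.2.ofReal⟩
        rw [e, intervalIntegral.integral_add ci1' (si1'.mul_const _),
          intervalIntegral.integral_mul_const, intervalIntegral.integral_ofReal,
          intervalIntegral.integral_ofReal, ci2, si2, dec r hr, dec 1 le_rfl]
        push_cast
        ring) t ht
    simpa only [hn1] using this
  -- the renewal equation
  set t := Real.exp τ with htdef
  have ht : 1 ≤ t := Real.one_le_exp hτ
  have ht0 : 0 < t := Real.exp_pos τ
  have hp1 : t⁻¹ ≤ 1 := inv_le_one_of_one_le₀ ht
  have hq : 0 ≤ 1 - t⁻¹ := by linarith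
  have hfint := hfin t ht
  set W : Measure ℝ := ENNReal.ofReal t • n t with hW
  have hWuniv : W univ = 1 := by
    have := hN t ht
    rw [hW, Measure.smul_apply, smul_eq_mul, ← ENNReal.ofReal_toReal (measure_ne_top (n t) univ),
      ← ENNReal.ofReal_mul ht0.le, mul_comm]
    rw [measureReal_def] at this
    rw [this, ENNReal.ofReal_one]
  have hWp : IsProbabilityMeasure W := ⟨hWuniv⟩
  have hfs : ∀ (c : ℝ) (ρ : Measure ℝ) [IsFiniteMeasure ρ],
      IsFiniteMeasure (ENNReal.ofReal c • ρ) := fun c ρ _ =>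
    Measure.smul_finite ρ ENNReal.ofReal_ne_top
  have htc : (t : ℂ) ≠ 0 := by exact_mod_cast ht0.ne'
  have hWeq : W = ENNReal.ofReal t⁻¹ • n0 + ENNReal.ofReal (1 - t⁻¹) • (n0.conv W) := by
    have f1 := hfs t⁻¹ n0
    have f2 := hfs (1 - t⁻¹) (n0.conv W)
    apply Measure.ext_of_charFun
    ext ξ
    rw [aux_charFun_add, aux_charFun_smul _ (inv_nonneg.2 ht0.le), aux_charFun_smul _ hq,
      charFun_conv, hW, aux_charFun_smul _ ht0.le]
    have := hchar ξ t ht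
    push_cast
    field_simp
    linear_combination this
  set ν : Measure ℝ := ENNReal.ofReal t⁻¹ • Measure.dirac 0 + ENNReal.ofReal (1 - t⁻¹) • W with hν
  have hνp : IsProbabilityMeasure ν := ⟨by
    rw [hν, Measure.add_apply, Measure.smul_apply, Measure.smul_apply, hWuniv, measure_univ,
      smul_eq_mul, smul_eq_mul, mul_one, mul_one, ← ENNReal.ofReal_add (inv_nonneg.2 ht0.le) hq]
    simp⟩
  have hconv : n0.conv ν = W := by
    have f1 := hfs t⁻¹ (Measure.dirac (0:ℝ))
    have f1' := hfs t⁻¹ n0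
    have f2 := hfs (1 - t⁻¹) W
    have f3 := hfs (1 - t⁻¹) (n0.conv W)
    apply Measure.ext_of_charFun
    ext ξ
    rw [charFun_conv, hν, aux_charFun_add, aux_charFun_smul _ (inv_nonneg.2 ht0.le),
      aux_charFun_smul _ hq, charFun_dirac]
    conv_rhs => rw [hWeq]
    rw [aux_charFun_add, aux_charFun_smul _ (inv_nonneg.2 ht0.le), aux_charFun_smul _ hq,
      charFun_conv]
    simp
    ring
  have hren : ν = ENNReal.ofReal t⁻¹ • Measure.dirac 0 +
      ENNReal.ofReal (1 - t⁻¹) • (n0.conv ν) := by rw [hconv]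
  have hWpos : W (Iic 0) = 0 := by
    rw [hW, Measure.smul_apply, hpos t ht, smul_zero]
  have hνpos : ν (Iio 0) = 0 := by
    have : W (Iio 0) = 0 := measure_mono_null Iio_subset_Iic_self hWpos
    rw [hν, Measure.add_apply, Measure.smul_apply, Measure.smul_apply, this,
      Measure.dirac_apply' _ measurableSet_Iio]
    simp
  have main := aux_renewal_rate (inv_pos.2 ht0) hq (by ring) h0 hνpos hren i1 e1 i2 e2 (t * xh)
    (by positivity)
  rw [hconv, inv_mul_cancel_left₀ ht0.ne'] at main
  have hval : W.real (Iic (t * xh)) = t * ((n t) (Ioc 0 (t * xh))).toReal := by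
    have hs : (n t) (Iic (t * xh)) = (n t) (Ioc 0 (t * xh)) := by
      apply le_antisymm
      · rw [← Iic_union_Ioc_eq_Iic (by positivity : (0:ℝ) ≤ t * xh)]
        refine (measure_union_le _ _).trans ?_
        rw [hpos t ht, zero_add]
      · exact measure_mono Ioc_subset_Iic_self
    rw [measureReal_def, hW, Measure.smul_apply, hs, smul_eq_mul, ENNReal.toReal_mul,
      ENNReal.toReal_ofReal ht0.le]
  rw [← hval, Real.exp_neg τ, ← htdef]
  refine main.trans ?_
  refine mul_le_mul_of_nonneg_right ?_ (inv_nonneg.2 ht0.le)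
  have : 0 ≤ 1 + 4 * Real.exp 1 * μ2 := by positivity
  nlinarith
end
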